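/- arXiv:1608.00926 — 2 statements merged into one kernel-verified Lean document; each statement's English description precedes it below -/
import Mathlib

section
/- Let S = k[x,y] be a polynomial ring in two variables over an algebraically closed field k, let p := x·(x−1, y)·S, let R := k + p, and let T := k[x, x^{-1}, y] ⊆ k(x,y). Then the only prime ideal t of T with t ∩ R = p is t₀ := (x−1, y)T; moreover ght_R(p) = 1 while ht_T(t₀) = 2. In particular, the depiction T of R is not saturated. -/
/-! Common framework: depictions of nonnoetherian integral domains (Beil).
`K` plays the role of the fraction field `Frac R`; all rings are `k`-subalgebras of `K`. -/

section Depictions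

variable {k K : Type*} [Field k] [Field K] [Algebra k K]

/-- The localization `A_p` of a subalgebra `A ⊆ K` at a prime ideal `p`,
viewed as a subalgebra of `K`. -/
def locAt (A : Subalgebra k K) (p : Ideal A) (hp : p.IsPrime) : Subalgebra k K where
  carrier := {x : K | ∃ a s : A, s ∉ p ∧ x * (s : K) = (a : K)}
  one_mem' := ⟨1, 1, (Ideal.ne_top_iff_one p).mp hp.ne_top, by simp⟩
  zero_mem' := ⟨0, 1, (Ideal.ne_top_iff_one p).mp hp.ne_top, by simp⟩
  mul_mem' := by
    rintro x y ⟨a, s, hs, hx⟩ ⟨b, t, ht, hy⟩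
    refine ⟨a * b, s * t, fun h => ((hp.mem_or_mem h).elim hs ht), ?_⟩
    have : x * y * ((s : K) * (t : K)) = (x * s) * (y * t) := by ring
    push_cast
    rw [this, hx, hy]
  add_mem' := by
    rintro x y ⟨a, s, hs, hx⟩ ⟨b, t, ht, hy⟩
    refine ⟨a * t + b * s, s * t, fun h => ((hp.mem_or_mem h).elim hs ht), ?_⟩
    have : (x + y) * ((s : K) * (t : K)) = (x * s) * t + (y * t) * s := by ring
    push_cast
    rw [this, hx, hy]
  algebraMap_mem' := fun c =>
    ⟨algebraMap k A c, 1, (Ideal.ne_top_iff_one p).mp hp.ne_top, by simp⟩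

lemma mem_locAt {A : Subalgebra k K} {p : Ideal A} {hp : p.IsPrime} {x : K} :
    x ∈ locAt A p hp ↔ ∃ a s : A, s ∉ p ∧ x * (s : K) = (a : K) := Iff.rfl

/-- `n ∈ U_{S/R}`: `n` is a maximal ideal of `S` with `R_{n ∩ R} = S_n`. -/
def memU (R S : Subalgebra k K) (h : R ≤ S) (n : Ideal S) : Prop :=
  ∃ hn : n.IsMaximal,
    locAt R (n.comap (Subalgebra.inclusion h)) (hn.isPrime.comap _) = locAt S n hn.isPrime

/-- `q ∈ Z_{S/R}`: `q` is a prime of `S` whose zero locus meets `U_{S/R}`,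
i.e. some `n ∈ U_{S/R}` contains `q`. -/
def memZ (R S : Subalgebra k K) (h : R ≤ S) (q : Ideal S) : Prop :=
  q.IsPrime ∧ ∃ n : Ideal S, memU R S h n ∧ q ≤ n

/-- `S` is a depiction of `R`. -/
structure IsDepiction (R S : Subalgebra k K) : Prop where
  le : R ≤ S
  fg : S.FG
  specSurj : ∀ p : Ideal R, p.IsPrime →
    ∃ q : Ideal S, q.IsPrime ∧ q.comap (Subalgebra.inclusion le) = p
  memU_iff : ∀ (n : Ideal S) (hn : n.IsMaximal),
    memU R S le n ↔
      IsNoetherianRing (locAt R (n.comap (Subalgebra.inclusion le)) (hn.isPrime.comap _))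
  nonempty : ∃ n : Ideal S, memU R S le n

/-- The height of an ideal `q`, as the Krull dimension of the set of primes contained in `q`. -/
noncomputable def htOf {A : Type*} [CommRing A] (q : Ideal A) : WithBot ℕ∞ :=
  Order.krullDim {p : PrimeSpectrum A // p.asIdeal ≤ q}

/-- The geometric height of a prime `p` of `R`: the minimum of the heights `ht_S q` over all
depictions `S` of `R` and primes `q` of `S` with `q ∩ R = p`. -/
noncomputable def ght (R : Subalgebra k K) (p : Ideal R) : WithBot ℕ∞ :=
  sInf {h | ∃ (S : Subalgebra k K) (hd : IsDepiction R S) (q : Ideal S),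
    q.IsPrime ∧ q.comap (Subalgebra.inclusion hd.le) = p ∧ h = htOf q}

/-- The geometric dimension of a prime `p` of `R`: `gdim p = dim R - ght p`. -/
noncomputable def gdim (R : Subalgebra k K) (p : Ideal R) : WithBot ℕ∞ :=
  Option.map₂ (· - ·) (ringKrullDim ↥R) (ght R p)

/-- `T := ⋂_{n ∈ U_{S/R}} S_n`, as a subalgebra of `K`. -/
noncomputable def depT (R S : Subalgebra k K) (h : R ≤ S) : Subalgebra k K :=
  sInf {L | ∃ (n : Ideal S) (hn : n.IsMaximal), memU R S h n ∧ L = locAt S n hn.isPrime}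

lemma le_depT (R S : Subalgebra k K) (h : R ≤ S) : S ≤ depT R S h := by
  refine le_sInf ?_
  rintro L ⟨n, hn, -, rfl⟩
  intro x hx
  exact ⟨⟨x, hx⟩, 1, (Ideal.ne_top_iff_one n).mp hn.ne_top, by simp⟩

/-- A depiction `S` of `R` witnesses `noetherian in codimension 1`:
every height 1 prime of `S` lies in `Z_{S/R}`. -/
def Witnessing (R S : Subalgebra k K) (h : R ≤ S) : Prop :=
  ∀ q : Ideal S, q.IsPrime → htOf q = 1 → memZ R S h q

/-- `R` is noetherian in codimension 1. -/
def NoethCodimOne (R : Subalgebra k K) : Prop :=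
  ∃ (S : Subalgebra k K) (hd : IsDepiction R S), Witnessing R S hd.le

/-- A depiction `S` of `R` is saturated if `ght (q ∩ R) = ht_S q` for every prime `q` of `S`
minimal over `(q ∩ R)S`. -/
def IsSaturated (R S : Subalgebra k K) (h : R ≤ S) : Prop :=
  ∀ q : Ideal S,
    q ∈ (Ideal.map (Subalgebra.inclusion h) (q.comap (Subalgebra.inclusion h))).minimalPrimes →
      ght R (q.comap (Subalgebra.inclusion h)) = htOf q

/-- The subalgebra `k + p ⊆ K`, for `p` an ideal of a subalgebra `S ⊆ K`. -/
def kPlus (S : Subalgebra k K) (p : Ideal S) : Subalgebra k K where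
  carrier := {x : K | ∃ (c : k) (f : S), f ∈ p ∧ x = algebraMap k K c + (f : K)}
  one_mem' := ⟨1, 0, p.zero_mem, by simp⟩
  zero_mem' := ⟨0, 0, p.zero_mem, by simp⟩
  mul_mem' := by
    rintro x y ⟨c, f, hf, rfl⟩ ⟨d, g, hg, rfl⟩
    refine ⟨c * d, algebraMap k S c * g + algebraMap k S d * f + f * g,
      add_mem (add_mem (p.mul_mem_left _ hg) (p.mul_mem_left _ hf)) (p.mul_mem_left _ hg),
      ?_⟩
    push_cast
    ring
  add_mem' := by
    rintro x y ⟨c, f, hf, rfl⟩ ⟨d, g, hg, rfl⟩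
    exact ⟨c + d, f + g, add_mem hf hg, by push_cast; ring⟩
  algebraMap_mem' := fun c => ⟨c, 0, p.zero_mem, by simp⟩

lemma kPlus_le (S : Subalgebra k K) (p : Ideal S) : kPlus S p ≤ S := by
  rintro x ⟨c, f, hf, rfl⟩
  exact add_mem (S.algebraMap_mem c) f.2

end Depictions

namespace Subalgebra

variable {k K : Type*} [Field k] [Field K] [Algebra k K]

lemma le_locAt (A : Subalgebra k K) (p : Ideal A) (hp : p.IsPrime) : A ≤ locAt A p hp :=
  fun x hx => ⟨⟨x, hx⟩, 1, (Ideal.ne_top_iff_one p).mp hp.ne_top, by simp⟩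

lemma isNoetherianRing_locAt (A : Subalgebra k K) [IsNoetherianRing A] (p : Ideal A)
    (hp : p.IsPrime) : IsNoetherianRing (locAt A p hp) := by
  let _ : Algebra A (locAt A p hp) := (inclusion (le_locAt A p hp)).toRingHom.toAlgebra
  have hne (s : A) (hs : s ∉ p) : (s : K) ≠ 0 := fun h =>
    hs (by rw [show s = 0 from Subtype.ext h]; exact p.zero_mem)
  have : IsLocalization p.primeCompl (locAt A p hp) := by
    refine ⟨fun s => ?_, fun z => ?_, fun {a b} h => ⟨1, ?_⟩⟩
    · refine IsUnit.of_mul_eq_one ⟨(s : K)⁻¹, 1, s, s.2, ?_⟩ (Subtype.ext ?_)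
      · simpa using inv_mul_cancel₀ (hne s s.2)
      · exact mul_inv_cancel₀ (hne s s.2)
    · obtain ⟨a, s, hs, h⟩ := z.2
      exact ⟨⟨a, ⟨s, hs⟩⟩, Subtype.ext h⟩
    · have : a = b := Subtype.ext (congrArg (fun z : locAt A p hp => (z : K)) h)
      rw [this]
  exact IsLocalization.isNoetherianRing p.primeCompl _ inferInstance

end Subalgebra

section Height

variable {A : Type*} [CommRing A]

lemma htOf_eq_height (q : Ideal A) [hq : q.IsPrime] : htOf q = (q.height : WithBot ℕ∞) := by
  rw [show q.height = Order.height (⟨q, hq⟩ : PrimeSpectrum A) from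
    PrimeSpectrum.height_eq_orderHeight ⟨q, hq⟩, Order.height_eq_krullDim_Iic]
  rfl

lemma one_le_htOf [IsDomain A] {q : Ideal A} [q.IsPrime] (hq : q ≠ ⊥) : 1 ≤ htOf q := by
  rw [htOf_eq_height]
  have := Ideal.height_add_one_le_of_lt_of_isPrime (bot_lt_iff_ne_bot.mpr hq)
  exact_mod_cast le_trans (by simp) this

lemma htOf_span_singleton [IsDomain A] [IsNoetherianRing A] {a : A} (ha : a ≠ 0)
    (h : (Ideal.span {a}).IsPrime) : htOf (Ideal.span {a}) = 1 := by
  refine le_antisymm ?_ (one_le_htOf (by simpa using ha))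
  rw [htOf_eq_height]
  exact_mod_cast Ideal.height_le_one_of_isPrincipal_of_mem_minimalPrimes (Ideal.span {a}) _
    (by rw [Ideal.minimalPrimes_eq_subsingleton_self]; rfl)

lemma htOf_span_pair [IsDomain A] [IsNoetherianRing A] {a b : A}
    (h : (Ideal.span {a, b}).IsPrime) {q : Ideal A} [q.IsPrime] (hq : q ≠ ⊥)
    (hlt : q < Ideal.span {a, b}) : htOf (Ideal.span {a, b}) = 2 := by
  rw [htOf_eq_height]
  have h1 := Ideal.height_add_one_le_of_lt_of_isPrime (bot_lt_iff_ne_bot.mpr hq)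
  have h2 := Ideal.height_add_one_le_of_lt_of_isPrime hlt
  have h3 := Ideal.height_le_spanFinrank (Ideal.span {a, b}) h.ne_top
  have h4 : (Ideal.span {a, b}).spanFinrank ≤ 2 :=
    (Submodule.spanFinrank_span_le_ncard_of_finite (by simp)).trans
      ((Set.ncard_insert_le a {b}).trans (by simp))
  have h5 : (2 : ℕ∞) ≤ (Ideal.span {a, b}).height := by
    refine le_trans ?_ h2
    rw [← one_add_one_eq_two]
    gcongr
    exact le_trans (by simp) h1
  exact congrArg _ (le_antisymm (h3.trans (by exact_mod_cast h4)) h5)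

end Height

section KPlus

variable {k K : Type*} [Field k] [Field K] [Algebra k K] {S : Subalgebra k K} {p : Ideal S}

lemma le_kPlus_of_mem {f : S} (hf : f ∈ p) : (f : K) ∈ kPlus S p := ⟨0, f, hf, by simp⟩

lemma eq_comap_of_comap_le (h : kPlus S p ≤ S) {P : Ideal (kPlus S p)} (hP : P ≠ ⊤)
    (hle : p.comap (Subalgebra.inclusion h) ≤ P) : P = p.comap (Subalgebra.inclusion h) := by
  refine le_antisymm (fun r hr => ?_) hle
  obtain ⟨c, f, hf, hrf⟩ := r.2
  have hfP : (⟨f, le_kPlus_of_mem hf⟩ : kPlus S p) ∈ P := hle hf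
  have hc : algebraMap k (kPlus S p) c ∈ P := by
    have : algebraMap k (kPlus S p) c = r - ⟨f, le_kPlus_of_mem hf⟩ :=
      Subtype.ext (by simp [hrf])
    rw [this]
    exact sub_mem hr hfP
  have hc0 : c = 0 := by
    by_contra hc0
    exact hP (P.eq_top_of_isUnit_mem hc ((isUnit_iff_ne_zero.mpr hc0).map _))
  have : r = ⟨f, le_kPlus_of_mem hf⟩ := Subtype.ext (by simp [hrf, hc0])
  rw [this]
  exact hf

lemma exists_prime_comap_eq (h : kPlus S p ≤ S) {q : Ideal S} (hq : q.IsPrime)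
    (hqp : q.comap (Subalgebra.inclusion h) = p.comap (Subalgebra.inclusion h))
    {P : Ideal (kPlus S p)} (hP : P.IsPrime) :
    ∃ Q : Ideal S, Q.IsPrime ∧ Q.comap (Subalgebra.inclusion h) = P := by
  by_cases hle : p.comap (Subalgebra.inclusion h) ≤ P
  · exact ⟨q, hq, hqp.trans (eq_comap_of_comap_le h hP.ne_top hle).symm⟩
  obtain ⟨g, hgp, hgP⟩ := SetLike.not_le_iff_exists.mp hle
  have hmem (s : S) : (s * Subalgebra.inclusion h g : S) ∈ p := p.mul_mem_left _ hgp
  let m (s : S) : kPlus S p := ⟨_, le_kPlus_of_mem (hmem s)⟩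
  have hm (s t : S) : m s * m t = g * m (s * t) := Subtype.ext (by simp [m]; ring)
  have hR (r : kPlus S p) : m (Subalgebra.inclusion h r) = r * g := Subtype.ext (by simp [m])
  let Q : Ideal S :=
    { carrier := {s | m s ∈ P}
      zero_mem' := by
        change m 0 ∈ P
        rw [show m 0 = 0 from Subtype.ext (by simp [m])]
        exact P.zero_mem
      add_mem' := fun {a b} ha hb => by
        change m (a + b) ∈ P
        rw [show m (a + b) = m a + m b from Subtype.ext (by simp [m]; ring)]
        exact add_mem ha hb
      smul_mem' := fun c s hs => by
        change m (c * s) ∈ P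
        refine (hP.mem_or_mem ?_).resolve_left hgP
        rw [← hm]
        exact P.mul_mem_left _ hs }
  refine ⟨Q, Ideal.isPrime_iff.mpr ⟨?_, fun {a b} hab => ?_⟩, ?_⟩
  · refine (Ideal.ne_top_iff_one Q).mpr fun h1 => hgP ?_
    have : m 1 = g := Subtype.ext (by simp [m])
    exact this ▸ h1
  · refine hP.mem_or_mem ?_
    rw [hm]
    exact P.mul_mem_left _ hab
  · ext r
    change m (Subalgebra.inclusion h r) ∈ P ↔ _
    rw [hR]
    exact ⟨fun hr => (hP.mem_or_mem hr).resolve_right hgP, fun hr => P.mul_mem_right _ hr⟩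

lemma locAt_comap_eq_of_not_le (h : kPlus S p ≤ S) {n : Ideal S} (hn : n.IsPrime) (hle : ¬ p ≤ n) :
    locAt (kPlus S p) (n.comap (Subalgebra.inclusion h)) (hn.comap _) = locAt S n hn := by
  refine le_antisymm ?_ ?_
  · rintro z ⟨a, s, hs, hz⟩
    exact ⟨Subalgebra.inclusion h a, Subalgebra.inclusion h s, hs, hz⟩
  · rintro z ⟨a, s, hs, hz⟩
    obtain ⟨g, hgp, hgn⟩ := SetLike.not_le_iff_exists.mp hle
    refine ⟨⟨(g * a : S), le_kPlus_of_mem (p.mul_mem_right _ hgp)⟩,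
      ⟨(g * s : S), le_kPlus_of_mem (p.mul_mem_right _ hgp)⟩,
      fun hmem => (hn.mem_or_mem (x := g) (y := s) hmem).elim hgn hs, ?_⟩
    push_cast
    rw [← hz]
    ring

open Polynomial in
lemma not_isNoetherianRing_locAt_kPlus (h : kPlus S p ≤ S) (φ : S →ₐ[k] k[X]) {x y : S}
    (hx : x ≠ 0) (hφp : ∀ f ∈ p, φ f = 0) (hφy : φ y = X) (hxy : x * y ∈ p)
    {P : Ideal (kPlus S p)} (hP : P.IsPrime) (hPp : P = p.comap (Subalgebra.inclusion h)) :
    ¬ IsNoetherianRing (locAt (kPlus S p) P hP) := by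
  intro hnoeth
  have hφR (r : kPlus S p) : ∃ c, φ (Subalgebra.inclusion h r) = C c ∧ (r ∉ P → c ≠ 0) := by
    obtain ⟨c, f, hf, hrf⟩ := r.2
    have hr : Subalgebra.inclusion h r = algebraMap k S c + f := Subtype.ext hrf
    refine ⟨c, ?_, ?_⟩
    · rw [hr, map_add, hφp f hf, add_zero, AlgHom.commutes]
      rfl
    · rintro hrP rfl
      refine hrP ?_
      rw [hPp, Ideal.mem_comap, hr]
      simpa using hf
  let J (m : ℕ) : Ideal (locAt (kPlus S p) P hP) :=
    { carrier := {a | ∃ s : kPlus S p, s ∉ P ∧ ∃ b : S, (φ b).natDegree ≤ m ∧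
        (a : K) * (s : K) = (x : K) * (b : K)}
      zero_mem' := ⟨1, (Ideal.ne_top_iff_one P).mp hP.ne_top, 0, by simp, by simp⟩
      add_mem' := by
        rintro a a' ⟨s, hs, b, hb, hab⟩ ⟨s', hs', b', hb', hab'⟩
        obtain ⟨c, hc, -⟩ := hφR s
        obtain ⟨c', hc', -⟩ := hφR s'
        refine ⟨s * s', fun hss => (hP.mem_or_mem hss).elim hs hs',
          Subalgebra.inclusion h s' * b + Subalgebra.inclusion h s * b', ?_, ?_⟩
        · rw [map_add, map_mul, map_mul, hc, hc']
          exact natDegree_add_le_of_degree_le ((natDegree_C_mul_le _ _).trans hb)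
            ((natDegree_C_mul_le _ _).trans hb')
        · push_cast
          simp only [Subalgebra.coe_inclusion]
          linear_combination (s' : K) * hab + (s : K) * hab'
      smul_mem' := by
        rintro a a' ⟨s', hs', b, hb, hab⟩
        obtain ⟨r, s, hs, har⟩ := a.2
        obtain ⟨c, hc, -⟩ := hφR r
        refine ⟨s * s', fun hss => (hP.mem_or_mem hss).elim hs hs',
          Subalgebra.inclusion h r * b, ?_, ?_⟩
        · rw [map_mul, hc]
          exact (natDegree_C_mul_le _ _).trans hb
        · simp only [smul_eq_mul]
          push_cast
          simp only [Subalgebra.coe_inclusion]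
          linear_combination (a' : K) * s' * har + (r : K) * hab }
  have hJ : Monotone J := fun m n hmn a ⟨s, hs, b, hb, hab⟩ => ⟨s, hs, b, hb.trans hmn, hab⟩
  obtain ⟨m, hm⟩ := monotone_stabilizes_iff_noetherian.mpr hnoeth ⟨J, hJ⟩
  have hmem : x * y ^ (m + 1) ∈ p := by
    rw [pow_succ', ← mul_assoc]
    exact p.mul_mem_right _ hxy
  let z : locAt (kPlus S p) P hP :=
    ⟨_, Subalgebra.le_locAt (kPlus S p) P hP (le_kPlus_of_mem hmem)⟩
  have hz : z ∈ J (m + 1) :=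
    ⟨1, (Ideal.ne_top_iff_one P).mp hP.ne_top, y ^ (m + 1), by simp [hφy], by simp [z]⟩
  rw [show J (m + 1) = J m from (hm (m + 1) m.le_succ).symm] at hz
  obtain ⟨s, hs, b, hb, hzb⟩ := hz
  have hb' : b = Subalgebra.inclusion h s * y ^ (m + 1) := by
    refine mul_left_cancel₀ hx (Subtype.ext ?_)
    push_cast
    rw [← hzb]
    simp [z]
    ring
  obtain ⟨c, hc, hc0⟩ := hφR s
  rw [hb', map_mul, map_pow, hc, hφy, natDegree_C_mul_X_pow _ _ (hc0 hs)] at hb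
  omega

lemma isDepiction_kPlus [IsNoetherianRing S] (h : kPlus S p ≤ S) (hfg : S.FG)
    (φ : S →ₐ[k] Polynomial k) {x y : S} (hx : x ≠ 0) (hφp : ∀ f ∈ p, φ f = 0)
    (hφy : φ y = Polynomial.X) (hxy : x * y ∈ p) {q : Ideal S} (hq : q.IsPrime)
    (hqp : q.comap (Subalgebra.inclusion h) = p.comap (Subalgebra.inclusion h))
    {n : Ideal S} (hn : n.IsMaximal) (hpn : ¬ p ≤ n) : IsDepiction (kPlus S p) S where
  le := h
  fg := hfg
  specSurj _ hP := exists_prime_comap_eq h hq hqp hP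
  memU_iff m hm := by
    refine ⟨fun ⟨_, hU⟩ => ?_, fun hnoeth => ?_⟩
    · rw [hU]
      exact Subalgebra.isNoetherianRing_locAt S m hm.isPrime
    · refine ⟨hm, locAt_comap_eq_of_not_le h hm.isPrime fun hle => ?_⟩
      exact not_isNoetherianRing_locAt_kPlus h φ hx hφp hφy hxy (hm.isPrime.comap _)
        (eq_comap_of_comap_le h (hm.isPrime.comap _).ne_top (Ideal.comap_mono hle)) hnoeth
  nonempty := ⟨n, hn, locAt_comap_eq_of_not_le h hn.isPrime hpn⟩

end KPlus

section Generators

variable {k K : Type*} [Field k] [Field K] [Algebra k K]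

lemma exists_sub_mem_of_eq_adjoin {s : Set K} {A : Subalgebra k K} (hA : A = Algebra.adjoin k s)
    (I : Ideal A) (B : Subalgebra k A) (hs : ∀ a : A, (a : K) ∈ s → ∃ b ∈ B, a - b ∈ I) (a : A) :
    ∃ b ∈ B, a - b ∈ I := by
  let C : Subalgebra k A := (B.map (Ideal.Quotient.mkₐ k I)).comap (Ideal.Quotient.mkₐ k I)
  have hC (a : A) : a ∈ C ↔ ∃ b ∈ B, a - b ∈ I := by
    refine exists_congr fun b => and_congr_right fun _ => ?_
    rw [← Ideal.neg_mem_iff, neg_sub]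
    exact Ideal.Quotient.mk_eq_mk_iff_sub_mem b a
  have hle : A ≤ C.map A.val := by
    conv_lhs => rw [hA]
    refine Algebra.adjoin_le fun z hz => ?_
    have hzA : z ∈ A := hA ▸ Algebra.subset_adjoin hz
    exact ⟨⟨z, hzA⟩, (hC _).mpr (hs ⟨z, hzA⟩ hz), rfl⟩
  obtain ⟨a', ha', h⟩ := hle a.2
  rw [← hC, ← show a' = a from Subtype.ext h]
  exact ha'

variable {x y : K} {S T : Subalgebra k K}

lemma exists_algHom_of_eq_adjoin (hxy : AlgebraicIndependent k ![x, y])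
    (hS : S = Algebra.adjoin k {x, y}) (hxS : x ∈ S) (hyS : y ∈ S)
    {B : Type*} [CommRing B] [Algebra k B] (a b : B) :
    ∃ φ : S →ₐ[k] B, φ ⟨x, hxS⟩ = a ∧ φ ⟨y, hyS⟩ = b := by
  have hS' : S = Algebra.adjoin k (Set.range ![x, y]) := by
    rw [hS, Matrix.range_cons_cons_empty]
  subst hS'
  refine ⟨(MvPolynomial.aeval ![a, b]).comp hxy.aevalEquiv.symm.toAlgHom, ?_, ?_⟩
  · have : hxy.aevalEquiv.symm ⟨x, hxS⟩ = MvPolynomial.X 0 :=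
      hxy.aevalEquiv.symm_apply_eq.mpr (Subtype.ext (by simp))
    simp [this]
  · have : hxy.aevalEquiv.symm ⟨y, hyS⟩ = MvPolynomial.X 1 :=
      hxy.aevalEquiv.symm_apply_eq.mpr (Subtype.ext (by simp))
    simp [this]

lemma exists_pow_mul_mem (hS : S = Algebra.adjoin k {x, y})
    (hT : T = Algebra.adjoin k {x, x⁻¹, y}) {t : K} (ht : t ∈ T) : ∃ n : ℕ, x ^ n * t ∈ S := by
  have hx : x ∈ S := hS ▸ Algebra.subset_adjoin (by simp)
  have hy : y ∈ S := hS ▸ Algebra.subset_adjoin (by simp)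
  rw [hT] at ht
  induction ht using Algebra.adjoin_induction with
  | mem z hz =>
    obtain rfl | rfl | rfl := hz
    · exact ⟨0, by simpa⟩
    · refine ⟨1, ?_⟩
      by_cases h : x = 0
      · simp [h]
      · simp [h]
    · exact ⟨0, by simpa⟩
  | algebraMap c => exact ⟨0, by simp⟩
  | add a b _ _ ha hb =>
    obtain ⟨m, ha⟩ := ha
    obtain ⟨n, hb⟩ := hb
    refine ⟨m + n, ?_⟩
    rw [show x ^ (m + n) * (a + b) = x ^ n * (x ^ m * a) + x ^ m * (x ^ n * b) by ring]
    exact add_mem (mul_mem (pow_mem hx n) ha) (mul_mem (pow_mem hx m) hb)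
  | mul a b _ _ ha hb =>
    obtain ⟨m, ha⟩ := ha
    obtain ⟨n, hb⟩ := hb
    refine ⟨m + n, ?_⟩
    rw [show x ^ (m + n) * (a * b) = (x ^ m * a) * (x ^ n * b) by ring]
    exact mul_mem ha hb

lemma exists_ringHom_laurent (hxy : AlgebraicIndependent k ![x, y])
    (hS : S = Algebra.adjoin k {x, y}) (hT : T = Algebra.adjoin k {x, x⁻¹, y}) (hx0 : x ≠ 0)
    (hxT : x ∈ T) (hyT : y ∈ T) {B : Type*} [CommRing B] [Algebra k B] {a b : B}
    (ha : IsUnit a) : ∃ ψ : T →+* B, ψ ⟨x, hxT⟩ = a ∧ ψ ⟨y, hyT⟩ = b := by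
  have hxS : x ∈ S := hS ▸ Algebra.subset_adjoin (by simp)
  have hyS : y ∈ S := hS ▸ Algebra.subset_adjoin (by simp)
  have hST : S ≤ T := by
    rw [hS]
    refine Algebra.adjoin_le ?_
    rintro z (rfl | rfl)
    exacts [hxT, hyT]
  have hxiT : x⁻¹ ∈ T := hT ▸ Algebra.subset_adjoin (by simp)
  obtain ⟨φ, hφx, hφy⟩ := exists_algHom_of_eq_adjoin hxy hS hxS hyS a b
  let _ : Algebra S T := (Subalgebra.inclusion hST).toRingHom.toAlgebra
  have hunit : IsUnit (⟨x, hxT⟩ : T) :=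
    IsUnit.of_mul_eq_one ⟨x⁻¹, hxiT⟩ (Subtype.ext (mul_inv_cancel₀ hx0))
  have : IsLocalization.Away (⟨x, hxS⟩ : S) T := by
    refine ⟨?_, fun z => ?_, fun {a b} h => ⟨1, ?_⟩⟩
    · rintro ⟨_, n, rfl⟩
      rw [map_pow]
      exact hunit.pow n
    · obtain ⟨n, hn⟩ := exists_pow_mul_mem hS hT z.2
      exact ⟨⟨⟨_, hn⟩, ⟨_, n, rfl⟩⟩, Subtype.ext (mul_comm _ _)⟩
    · have : a = b := Subtype.ext (congrArg (fun z : T => (z : K)) h)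
      rw [this]
  have hg : IsUnit ((φ : S →+* B) ⟨x, hxS⟩) := by simpa [hφx] using ha
  exact ⟨IsLocalization.Away.lift (S := T) (⟨x, hxS⟩ : S) hg,
    (IsLocalization.Away.lift_eq _ hg ⟨x, hxS⟩).trans hφx,
    (IsLocalization.Away.lift_eq _ hg ⟨y, hyS⟩).trans hφy⟩

lemma ker_eq_span_of_eq_adjoin (hS : S = Algebra.adjoin k {x, y}) (hxS : x ∈ S) (hyS : y ∈ S)
    (φ : S →ₐ[k] Polynomial k) (hφx : φ ⟨x, hxS⟩ = 0) (hφy : φ ⟨y, hyS⟩ = Polynomial.X) :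
    RingHom.ker φ = Ideal.span {⟨x, hxS⟩} := by
  refine le_antisymm (fun s hs => ?_) ?_
  · have hgen (a : S) (ha : (a : K) ∈ ({x, y} : Set K)) :
        ∃ b ∈ (Polynomial.aeval (R := k) (⟨y, hyS⟩ : S)).range,
          a - b ∈ Ideal.span {(⟨x, hxS⟩ : S)} := by
      obtain h | h := ha
      · refine ⟨0, zero_mem _, ?_⟩
        rw [sub_zero, show a = ⟨x, hxS⟩ from Subtype.ext h]
        exact Ideal.mem_span_singleton_self _
      · exact ⟨a, ⟨Polynomial.X, by simpa using Subtype.ext h.symm⟩, by simp⟩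
    obtain ⟨_, ⟨f, rfl⟩, hf⟩ := exists_sub_mem_of_eq_adjoin hS _ _ hgen s
    obtain ⟨g, hg⟩ := Ideal.mem_span_singleton'.mp hf
    have hf0 : f = 0 := by
      have := congrArg φ hg
      simpa [hφx, RingHom.mem_ker.mp hs, ← Polynomial.aeval_algHom_apply, hφy] using this
    simpa [hf0] using hf
  · rw [Ideal.span_singleton_le_iff_mem]
    exact hφx

lemma isMaximal_of_forall_exists_sub_algebraMap_mem {A : Type*} [CommRing A] [Algebra k A]
    {I : Ideal A} (hI : I ≠ ⊤) (h : ∀ a, ∃ b ∈ (⊥ : Subalgebra k A), a - b ∈ I) :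
    I.IsMaximal := by
  refine Ideal.isMaximal_def.mpr ⟨hI, fun J hJ => ?_⟩
  obtain ⟨a, haJ, haI⟩ := SetLike.exists_of_lt hJ
  obtain ⟨b, hb, hab⟩ := h a
  obtain ⟨c, rfl⟩ := Algebra.mem_bot.mp hb
  have hc : c ≠ 0 := by
    rintro rfl
    exact haI (by simpa using hab)
  refine J.eq_top_of_isUnit_mem ?_ ((isUnit_iff_ne_zero.mpr hc).map (algebraMap k A))
  simpa using sub_mem haJ (hJ.le hab)

lemma exists_sub_algebraMap_mem_laurent (hT : T = Algebra.adjoin k {x, x⁻¹, y}) (hx0 : x ≠ 0)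
    (hx1T : x - 1 ∈ T) (hyT : y ∈ T) (t : T) :
    ∃ b ∈ (⊥ : Subalgebra k T), t - b ∈ Ideal.span ({⟨x - 1, hx1T⟩, ⟨y, hyT⟩} : Set T) := by
  have hxiT : x⁻¹ ∈ T := hT ▸ Algebra.subset_adjoin (by simp)
  refine exists_sub_mem_of_eq_adjoin hT _ _ (fun a ha => ?_) t
  obtain h | h | h := ha
  · refine ⟨1, one_mem _, ?_⟩
    rw [show a - 1 = ⟨x - 1, hx1T⟩ from Subtype.ext (by simp [h])]
    exact Ideal.subset_span (by simp)
  · refine ⟨1, one_mem _, ?_⟩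
    rw [show a - 1 = -⟨x⁻¹, hxiT⟩ * ⟨x - 1, hx1T⟩ from Subtype.ext (by
      push_cast
      rw [h]
      field_simp
      ring)]
    exact Ideal.mul_mem_left _ _ (Ideal.subset_span (by simp))
  · refine ⟨0, zero_mem _, ?_⟩
    rw [sub_zero, show a = ⟨y, hyT⟩ from Subtype.ext h]
    exact Ideal.subset_span (by simp)

end Generators

/-- With `S = k[x,y]`, `p = x·(x-1,y)·S`, `R = k + p`, and `T = k[x,x⁻¹,y]`: the only prime
`t` of `T` with `t ∩ R = p` is `t₀ = (x-1,y)T`; moreover `ght p = 1` while `ht_T t₀ = 2`.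
In particular the depiction `T` of `R` is not saturated. -/
theorem laurent_depiction_not_saturated (k K : Type*) [Field k] [IsAlgClosed k] [Field K] [Algebra k K]
    (x y : K) (hxy : AlgebraicIndependent k ![x, y])
    (S : Subalgebra k K) (hSdef : S = Algebra.adjoin k {x, y})
    (hxS : x ∈ S) (hx1S : x - 1 ∈ S) (hyS : y ∈ S)
    (p : Ideal S)
    (hpdef : p = Ideal.span ({⟨x, hxS⟩} : Set S) * Ideal.span ({⟨x - 1, hx1S⟩, ⟨y, hyS⟩} : Set S))
    (R : Subalgebra k K) (hRdef : R = kPlus S p)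
    (hfrac : IsFractionRing ↑R K)
    (T : Subalgebra k K) (hTdef : T = Algebra.adjoin k {x, x⁻¹, y})
    (hRS : R ≤ S) (hRT : R ≤ T) (hx1T : x - 1 ∈ T) (hyT : y ∈ T)
    (t₀ : Ideal T) (ht₀def : t₀ = Ideal.span ({⟨x - 1, hx1T⟩, ⟨y, hyT⟩} : Set T)) :
    t₀.IsPrime ∧
      t₀.comap (Subalgebra.inclusion hRT) = p.comap (Subalgebra.inclusion hRS) ∧
      (∀ t : Ideal T, t.IsPrime →
        t.comap (Subalgebra.inclusion hRT) = p.comap (Subalgebra.inclusion hRS) → t = t₀) ∧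
      ght R (p.comap (Subalgebra.inclusion hRS)) = 1 ∧
      htOf t₀ = 2 ∧
      ¬ IsSaturated R T hRT := by
  have hx0 : x ≠ 0 := by simpa using hxy.ne_zero 0
  have hy0 : y ≠ 0 := by simpa using hxy.ne_zero 1
  have hxT : x ∈ T := hTdef ▸ Algebra.subset_adjoin (by simp)
  have hxiT : x⁻¹ ∈ T := hTdef ▸ Algebra.subset_adjoin (by simp)
  have hST : S ≤ T := by
    rw [hSdef]
    refine Algebra.adjoin_le ?_
    rintro z (rfl | rfl)
    exacts [hxT, hyT]
  have hSfg : S.FG := hSdef ▸ Subalgebra.fg_def.mpr ⟨_, by simp, rfl⟩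
  have hTfg : T.FG := hTdef ▸ Subalgebra.fg_def.mpr ⟨_, by simp, rfl⟩
  have := isNoetherianRing_of_fg hSfg
  have := isNoetherianRing_of_fg hTfg
  have hxyp : (⟨x, hxS⟩ * ⟨y, hyS⟩ : S) ∈ p := by
    rw [hpdef]
    exact Ideal.mul_mem_mul (Ideal.mem_span_singleton_self _) (Ideal.subset_span (by simp))
  have hxx1p : (⟨x, hxS⟩ * ⟨x - 1, hx1S⟩ : S) ∈ p := by
    rw [hpdef]
    exact Ideal.mul_mem_mul (Ideal.mem_span_singleton_self _) (Ideal.subset_span (by simp))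
  have hpx : p ≤ Ideal.span {⟨x, hxS⟩} := hpdef ▸ Ideal.mul_le_left
  obtain ⟨φ, hφx, hφy⟩ :=
    exists_algHom_of_eq_adjoin hxy hSdef hxS hyS (0 : Polynomial k) Polynomial.X
  have hker := ker_eq_span_of_eq_adjoin hSdef hxS hyS φ hφx hφy
  have hq : (Ideal.span {(⟨x, hxS⟩ : S)}).IsPrime := hker ▸ RingHom.ker_isPrime φ
  obtain ⟨ψ, hψx, hψy⟩ := exists_ringHom_laurent (B := PowerSeries k) (a := 1 + PowerSeries.X)
    (b := 0) hxy hSdef hTdef hx0 hxT hyT (PowerSeries.isUnit_iff_constantCoeff.mpr (by simp))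
  have hψx1 : ψ ⟨x - 1, hx1T⟩ = PowerSeries.X := by
    rw [show (⟨x - 1, hx1T⟩ : T) = ⟨x, hxT⟩ - 1 from rfl, map_sub, hψx, map_one]
    ring
  have hle : t₀ ≤ RingHom.ker ((PowerSeries.constantCoeff (R := k)).comp ψ) := by
    rw [ht₀def, Ideal.span_le]
    rintro z (rfl | rfl)
    · simp [RingHom.mem_ker, hψx1]
    · simp [RingHom.mem_ker, hψy]
  have ht₀max : t₀.IsMaximal :=
    isMaximal_of_forall_exists_sub_algebraMap_mem
      (ne_top_of_le_ne_top (RingHom.ker_ne_top _) hle)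
      (ht₀def ▸ exists_sub_algebraMap_mem_laurent hTdef hx0 hx1T hyT)
  have ht₀ker := ht₀max.eq_of_le (RingHom.ker_ne_top _) hle
  have ht₀le (I : Ideal T) (h1 : (⟨x, hxT⟩ * ⟨x - 1, hx1T⟩ : T) ∈ I)
      (h2 : (⟨x, hxT⟩ * ⟨y, hyT⟩ : T) ∈ I) : t₀ ≤ I := by
    have hcancel (z : T) (hz : ⟨x, hxT⟩ * z ∈ I) : z ∈ I := by
      have := I.mul_mem_left ⟨x⁻¹, hxiT⟩ hz
      rwa [← mul_assoc, show (⟨x⁻¹, hxiT⟩ * ⟨x, hxT⟩ : T) = 1 from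
        Subtype.ext (inv_mul_cancel₀ hx0), one_mul] at this
    rw [ht₀def, Ideal.span_le]
    rintro z (rfl | rfl)
    exacts [hcancel _ h1, hcancel _ h2]
  subst hRdef
  let xyR : kPlus S p := ⟨_, le_kPlus_of_mem hxyp⟩
  let xx1R : kPlus S p := ⟨_, le_kPlus_of_mem hxx1p⟩
  have hcomap : t₀.comap (Subalgebra.inclusion hRT) = p.comap (Subalgebra.inclusion hRS) := by
    refine eq_comap_of_comap_le hRS (ht₀max.isPrime.comap _).ne_top fun r hr => ?_
    have hmap : p.map (Subalgebra.inclusion hST) ≤ t₀ := by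
      rw [hpdef, Ideal.map_mul, Ideal.map_span _ {_, _}, Set.image_pair, ht₀def]
      exact Ideal.mul_le_right
    exact hmap (Ideal.mem_map_of_mem (Subalgebra.inclusion hST) hr)
  have hght : ght (kPlus S p) (p.comap (Subalgebra.inclusion hRS)) = 1 := by
    have hqp : (Ideal.span {(⟨x, hxS⟩ : S)}).comap (Subalgebra.inclusion hRS) =
        p.comap (Subalgebra.inclusion hRS) :=
      eq_comap_of_comap_le hRS (hq.comap _).ne_top (Ideal.comap_mono hpx)
    obtain ⟨θ, hθx, hθy⟩ := exists_algHom_of_eq_adjoin hxy hSdef hxS hyS (1 : k) 1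
    have hx0' : (⟨x, hxS⟩ : S) ≠ 0 := fun h => hx0 (congrArg Subtype.val h)
    have hd : IsDepiction (kPlus S p) S :=
      isDepiction_kPlus hRS hSfg φ hx0' (fun f hf => RingHom.mem_ker.mp (hker ▸ hpx hf)) hφy hxyp
        hq hqp (RingHom.ker_isMaximal_of_surjective θ fun c => ⟨algebraMap k S c, θ.commutes c⟩)
        fun hp => one_ne_zero (α := k) (by
          rw [← RingHom.mem_ker.mp (hp hxyp), map_mul, hθx, hθy, one_mul])
    refine le_antisymm (sInf_le ⟨S, hd, _, hq, hqp, (htOf_span_singleton hx0' hq).symm⟩) ?_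
    refine le_sInf ?_
    rintro _ ⟨D, hD, q, hqprime, hqD, rfl⟩
    refine one_le_htOf fun hbot => ?_
    have hmem : xyR ∈ q.comap (Subalgebra.inclusion hD.le) := hqD ▸ hxyp
    rw [hbot] at hmem
    exact mul_ne_zero hx0 hy0 (congrArg Subtype.val (Ideal.mem_bot.mp hmem))
  have hht : htOf t₀ = 2 := by
    have hyker : (⟨y, hyT⟩ : T) ∈ RingHom.ker ψ := hψy
    have hlt : RingHom.ker ψ < t₀ := by
      refine lt_of_le_of_ne (fun z hz => ?_) fun h => ?_
      · rw [ht₀ker, RingHom.mem_ker, RingHom.comp_apply, RingHom.mem_ker.mp hz, map_zero]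
      · have : (⟨x - 1, hx1T⟩ : T) ∈ RingHom.ker ψ := by
          rw [h, ht₀def]
          exact Ideal.subset_span (by simp)
        exact PowerSeries.X_ne_zero (hψx1.symm.trans this)
    have := RingHom.ker_isPrime ψ
    subst ht₀def
    refine htOf_span_pair ht₀max.isPrime (fun h => ?_) hlt
    rw [h] at hyker
    exact hy0 (congrArg Subtype.val (Ideal.mem_bot.mp hyker))
  refine ⟨ht₀max.isPrime, hcomap, fun t ht htp => ?_, hght, hht, fun hsat => ?_⟩
  · have h1 : xx1R ∈ t.comap (Subalgebra.inclusion hRT) := htp ▸ hxx1p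
    have h2 : xyR ∈ t.comap (Subalgebra.inclusion hRT) := htp ▸ hxyp
    exact (ht₀max.eq_of_le ht.ne_top (ht₀le t h1 h2)).symm
  · have h := hsat t₀ ⟨⟨ht₀max.isPrime, Ideal.map_comap_le⟩, fun J hJ _ => ?_⟩
    · rw [hcomap, hght, hht] at h
      exact absurd h (by decide)
    · have h1 : xx1R ∈ t₀.comap (Subalgebra.inclusion hRT) := hcomap ▸ hxx1p
      have h2 : xyR ∈ t₀.comap (Subalgebra.inclusion hRT) := hcomap ▸ hxyp
      exact ht₀le J (hJ.2 (Ideal.mem_map_of_mem _ h1)) (hJ.2 (Ideal.mem_map_of_mem _ h2))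
end

section
/- Let S₁ = k[x,y,z] be a polynomial ring in three variables over an algebraically closed field k and let R := k + (x,y)S₁, where (x,y)S₁ is the ideal of S₁ generated by x and y. Then R is noetherian in codimension 1 and S₁ is the unique maximal depiction of R: S₁ is a depiction of R and every depiction of R is contained in S₁. -/
section

variable {k K : Type*} [Field k] [Field K] [Algebra k K]

lemma le_locAt (A : Subalgebra k K) (p : Ideal A) (hp : p.IsPrime) : A ≤ locAt A p hp :=
  fun x hx => ⟨⟨x, hx⟩, 1, (Ideal.ne_top_iff_one p).mp hp.ne_top, by simp⟩

/-- The inclusion `A → A_p`. -/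
abbrev locAtAlgebra (A : Subalgebra k K) (p : Ideal A) (hp : p.IsPrime) :
    Algebra A (locAt A p hp) :=
  (Subalgebra.inclusion (le_locAt A p hp)).toRingHom.toAlgebra

lemma isLocalization_locAt (A : Subalgebra k K) (p : Ideal A) (hp : p.IsPrime) :
    letI := locAtAlgebra A p hp
    IsLocalization p.primeCompl (locAt A p hp) := by
  let := locAtAlgebra A p hp
  have hne : ∀ s : A, s ∉ p → (s : K) ≠ 0 := by
    rintro s hs h
    exact hs (by rw [show s = 0 from Subtype.ext h]; exact p.zero_mem)
  refine (isLocalization_iff _ _).mpr ⟨?_, ?_, ?_⟩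
  · rintro ⟨s, hs⟩
    refine IsUnit.of_mul_eq_one
      ⟨(s : K)⁻¹, 1, s, hs, by simp [inv_mul_cancel₀ (hne s hs)]⟩ ?_
    exact Subtype.ext (mul_inv_cancel₀ (hne s hs))
  · rintro ⟨u, a, s, hs, h⟩
    exact ⟨(a, ⟨s, hs⟩), Subtype.ext h⟩
  · intro a b h
    have h' : (a : K) = b := congrArg (Subtype.val : locAt A p hp → K) h
    exact ⟨1, by rw [Subtype.ext h']⟩

lemma isNoetherianRing_locAt (A : Subalgebra k K) [IsNoetherianRing A] (p : Ideal A)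
    (hp : p.IsPrime) : IsNoetherianRing (locAt A p hp) := by
  let := locAtAlgebra A p hp
  have := isLocalization_locAt A p hp
  exact IsLocalization.isNoetherianRing p.primeCompl (locAt A p hp) ‹_›

lemma coe_mem_kPlus {S : Subalgebra k K} {P : Ideal S} {f : S} (hf : f ∈ P) :
    (f : K) ∈ kPlus S P :=
  ⟨0, f, hf, by simp⟩

lemma locAt_comap_kPlus (S : Subalgebra k K) (P : Ideal S) (n : Ideal S) (hn : n.IsPrime)
    (hPn : ¬ P ≤ n) :
    locAt (kPlus S P) (n.comap (Subalgebra.inclusion (kPlus_le S P))) (hn.comap _) =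
      locAt S n hn := by
  ext u
  simp only [mem_locAt]
  constructor
  · rintro ⟨a, s, hs, h⟩
    exact ⟨Subalgebra.inclusion (kPlus_le S P) a, Subalgebra.inclusion (kPlus_le S P) s, hs, h⟩
  · rintro ⟨a, s, hs, h⟩
    obtain ⟨f, hfP, hfn⟩ := SetLike.not_le_iff_exists.mp hPn
    refine ⟨⟨_, coe_mem_kPlus (P.mul_mem_left a hfP)⟩,
      ⟨_, coe_mem_kPlus (P.mul_mem_left s hfP)⟩, fun hm => ?_, ?_⟩
    · exact (hn.mem_or_mem (show s * f ∈ n from hm)).elim hs hfn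
    · push_cast
      rw [← mul_assoc, h]

lemma exists_comap_kPlus_eq (S : Subalgebra k K) (P : Ideal S) (hP : P ≠ ⊤)
    (p : Ideal (kPlus S P)) (hp : p.IsPrime) :
    ∃ q : Ideal S, q.IsPrime ∧ q.comap (Subalgebra.inclusion (kPlus_le S P)) = p := by
  by_cases hle : ∀ f (hf : f ∈ P), (⟨(f : K), coe_mem_kPlus hf⟩ : kPlus S P) ∈ p
  · obtain ⟨q, hq, hPq⟩ := Ideal.exists_le_maximal P hP
    refine ⟨q, hq.isPrime, ?_⟩
    have key : ∀ (I : Ideal (kPlus S P)), I.IsPrime →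
        (∀ f (hf : f ∈ P), (⟨(f : K), coe_mem_kPlus hf⟩ : kPlus S P) ∈ I) →
        ∀ (c : k) (f : S) (hf : f ∈ P) (h : algebraMap k K c + (f : K) ∈ kPlus S P),
          (⟨_, h⟩ : kPlus S P) ∈ I ↔ c = 0 := by
      intro I hI hPI c f hf h
      have hsum : (⟨_, h⟩ : kPlus S P) =
          algebraMap k (kPlus S P) c + ⟨(f : K), coe_mem_kPlus hf⟩ := rfl
      rw [hsum, Ideal.add_mem_iff_left _ (hPI f hf)]
      refine ⟨fun hc => ?_, fun hc => by simp [hc]⟩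
      by_contra hc0
      exact hI.ne_top (Ideal.eq_top_of_isUnit_mem _ hc ((isUnit_iff_ne_zero.mpr hc0).map _))
    ext ⟨u, c, f, hf, rfl⟩
    exact (key (q.comap (Subalgebra.inclusion (kPlus_le S P))) (hq.isPrime.comap _)
      (fun g hg => hPq hg) c f hf _).trans (key p hp hle c f hf _).symm
  · push Not at hle
    obtain ⟨f, hfP, hfp⟩ := hle
    let m : S → kPlus S P := fun s => ⟨((s * f : S) : K), coe_mem_kPlus (P.mul_mem_left s hfP)⟩
    have hmr : ∀ r : kPlus S P,
        m (Subalgebra.inclusion (kPlus_le S P) r) = r * ⟨f, coe_mem_kPlus hfP⟩ :=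
      fun r => rfl
    have hmul : ∀ s t : S, m s * m t = m (s * t) * ⟨f, coe_mem_kPlus hfP⟩ := by
      intro s t
      apply Subtype.ext
      simp only [m]
      push_cast
      ring
    let q : Ideal S :=
      { carrier := {s | m s ∈ p}
        zero_mem' := by
          have : m 0 = 0 := Subtype.ext (by simp [m])
          simp [this]
        add_mem' := by
          intro s t hs ht
          have : m (s + t) = m s + m t := Subtype.ext (by simp [m, add_mul])
          simpa [this] using p.add_mem hs ht
        smul_mem' := by
          intro t s hs
          have h : m t * m s ∈ p := p.mul_mem_left _ hs
          rw [hmul] at h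
          exact (hp.mem_or_mem h).resolve_right hfp }
    have hmem : ∀ s, s ∈ q ↔ m s ∈ p := fun s => Iff.rfl
    have hcomap : q.comap (Subalgebra.inclusion (kPlus_le S P)) = p := by
      ext r
      rw [Ideal.mem_comap, hmem, hmr]
      exact ⟨fun h => (hp.mem_or_mem h).resolve_right hfp, fun h => p.mul_mem_right _ h⟩
    refine ⟨q, ⟨?_, ?_⟩, hcomap⟩
    · intro hq
      exact hp.ne_top (by rw [← hcomap, hq, Ideal.comap_top])
    · intro s t hst
      rw [hmem] at hst
      have h : m s * m t ∈ p := by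
        rw [hmul]
        exact p.mul_mem_right _ hst
      exact hp.mem_or_mem h

lemma not_isIntegral_C_mul_X {A : Type*} [CommRing A] (χ : A →+* k) {c : k} (hc : c ≠ 0) :
    ¬ (Polynomial.C.comp χ).IsIntegralElem (Polynomial.C c * Polynomial.X) := by
  rintro ⟨p, hp, h⟩
  rw [← Polynomial.eval₂_map] at h
  have h' : (p.map χ).comp (Polynomial.C c * Polynomial.X) = 0 := h
  rw [Polynomial.comp_C_mul_X_eq_zero_iff (mem_nonZeroDivisors_of_ne_zero hc)] at h'
  exact (hp.map χ).ne_zero h'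

/-- An element `z` with `x zⁱ ∈ L` for all `i`, for some nonzero `x ∈ L`, is integral over `L`
when `L` is noetherian. -/
lemma isIntegral_of_forall_mul_pow_mem (L : Subalgebra k K) [IsNoetherianRing L] {x z : K}
    (hx : x ≠ 0) (h : ∀ i : ℕ, x * z ^ i ∈ L) : IsIntegral L z := by
  let I : Ideal L :=
    { carrier := {l | ∀ i : ℕ, (l : K) * z ^ i ∈ L}
      zero_mem' := fun i => by simp
      add_mem' := fun {a b} ha hb i => by
        have := add_mem (ha i) (hb i)
        rwa [← add_mul] at this
      smul_mem' := fun c a ha i => by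
        have := mul_mem c.2 (ha i)
        rwa [← mul_assoc] at this }
  have hxL : x ∈ L := by simpa using h 0
  refine isIntegral_of_smul_mem_submodule (Submodule.map (Algebra.linearMap L K) I) ?_ ?_ z ?_
  · rw [Submodule.ne_bot_iff]
    exact ⟨x, ⟨⟨x, hxL⟩, h, rfl⟩, hx⟩
  · exact Submodule.FG.map _ (IsNoetherian.noetherian I)
  · rintro _ ⟨l, hl, rfl⟩
    refine ⟨⟨(l : K) * z, by simpa using hl 1⟩, fun i => ?_, mul_comm _ _⟩
    have := hl (i + 1)
    rwa [pow_succ', ← mul_assoc] at this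

lemma not_isNoetherianRing_locAt_kPlus_s19 (S : Subalgebra k K) (P : Ideal S)
    (φ : S →ₐ[k] Polynomial k) (hφP : ∀ f ∈ P, φ f = 0) {Z : S} (hφZ : φ Z = Polynomial.X)
    {x : S} (hxP : x ∈ P) (hx0 : x ≠ 0) (n : Ideal S) (hn : n.IsPrime) (hPn : P ≤ n) :
    ¬ IsNoetherianRing
      (locAt (kPlus S P) (n.comap (Subalgebra.inclusion (kPlus_le S P))) (hn.comap _)) := by
  intro hN
  set R := kPlus S P
  let ι : R →+* S := (Subalgebra.inclusion (kPlus_le S P)).toRingHom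
  set m : Ideal R := n.comap (Subalgebra.inclusion (kPlus_le S P))
  have hm : m.IsPrime := hn.comap _
  have hint : IsIntegral (locAt R m hm) (Z : K) := by
    refine isIntegral_of_forall_mul_pow_mem _ (x := (x : K)) (by simpa using hx0) fun i => ?_
    have := coe_mem_kPlus (P.mul_mem_right (Z ^ i) hxP)
    push_cast at this
    exact le_locAt R m hm this
  let := locAtAlgebra R m hm
  have := isLocalization_locAt R m hm
  have : IsScalarTower R (locAt R m hm) K := IsScalarTower.of_algebraMap_eq fun _ => rfl
  obtain ⟨⟨s, hs⟩, p, hp, hp0⟩ := hint.exists_multiple_integral_of_isLocalization m.primeCompl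
  have h1 : (algebraMap S K) (p.eval₂ ι (ι s * Z)) = 0 := by
    rw [Polynomial.hom_eval₂]
    exact hp0
  have h2 : p.eval₂ ι (ι s * Z) = 0 := Subtype.ext h1
  have hφι : ∀ r : R, ∃ c : k, φ (ι r) = Polynomial.C c ∧ (r ∉ m → c ≠ 0) := by
    rintro ⟨_, c, f, hf, rfl⟩
    have hr : ι ⟨algebraMap k K c + (f : K), c, f, hf, rfl⟩ = algebraMap k S c + f := rfl
    refine ⟨c, by rw [hr, map_add, hφP f hf, AlgHom.commutes, add_zero]; rfl, ?_⟩
    rintro h rfl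
    refine h (show ι _ ∈ n from ?_)
    rw [hr]
    simpa using hPn hf
  let χ : R →+* k := (Polynomial.constantCoeff.comp φ.toRingHom).comp ι
  have hχ : Polynomial.C.comp χ = φ.toRingHom.comp ι := by
    ext1 r
    obtain ⟨c, hc, -⟩ := hφι r
    simp [χ, hc]
  obtain ⟨c, hc, hc0⟩ := hφι s
  refine not_isIntegral_C_mul_X χ (hc0 hs) ⟨p, hp, ?_⟩
  have h3 := congrArg φ.toRingHom h2
  rw [Polynomial.hom_eval₂, ← hχ] at h3
  simpa [hc, hφZ] using h3


lemma isDepiction_kPlus_s19 (S : Subalgebra k K) (hS : S.FG) (P : Ideal S) (hP : P ≠ ⊤)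
    (φ : S →ₐ[k] Polynomial k) (hφP : ∀ f ∈ P, φ f = 0) {Z : S} (hφZ : φ Z = Polynomial.X)
    {x : S} (hxP : x ∈ P) (hx0 : x ≠ 0) {n₀ : Ideal S} (hn₀ : n₀.IsMaximal) (hPn₀ : ¬ P ≤ n₀) :
    IsDepiction (kPlus S P) S where
  le := kPlus_le S P
  fg := hS
  specSurj := exists_comap_kPlus_eq S P hP
  memU_iff n hn := by
    have : IsNoetherianRing S := isNoetherianRing_of_fg hS
    constructor
    · rintro ⟨_, h⟩
      rw [h]
      exact isNoetherianRing_locAt S n _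
    · intro hN
      exact ⟨hn, locAt_comap_kPlus S P n hn.isPrime fun hPn =>
        not_isNoetherianRing_locAt_kPlus_s19 S P φ hφP hφZ hxP hx0 n hn.isPrime hPn hN⟩
  nonempty := ⟨n₀, hn₀, locAt_comap_kPlus S P n₀ hn₀.isPrime hPn₀⟩

lemma memZ_kPlus (S : Subalgebra k K) [IsJacobsonRing S] (P : Ideal S) (q : Ideal S)
    (hq : q.IsPrime) (hPq : ¬ P ≤ q) : memZ (kPlus S P) S (kPlus_le S P) q := by
  refine ⟨hq, ?_⟩
  obtain ⟨f, hfP, hfq⟩ := SetLike.not_le_iff_exists.mp hPq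
  rw [← isJacobsonRing_iff_prime_eq.mp ‹_› q hq, Ideal.jacobson, Ideal.mem_sInf] at hfq
  push Not at hfq
  obtain ⟨n, ⟨hqn, hn⟩, hfn⟩ := hfq
  exact ⟨n, ⟨hn, locAt_comap_kPlus S P n hn.isPrime fun h => hfn (h hfP)⟩, hqn⟩

lemma two_le_htOf {A : Type*} [CommRing A] {p₀ p₁ q : Ideal A} (h₀ : p₀.IsPrime)
    (h₁ : p₁.IsPrime) (hq : q.IsPrime) (h01 : p₀ < p₁) (h1q : p₁ < q) : 2 ≤ htOf q := by
  let c : LTSeries {p : PrimeSpectrum A // p.asIdeal ≤ q} :=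
    { length := 2
      toFun := ![⟨⟨p₀, h₀⟩, (h01.trans h1q).le⟩, ⟨⟨p₁, h₁⟩, h1q.le⟩, ⟨⟨q, hq⟩, le_rfl⟩]
      step := by
        intro i
        fin_cases i
        · exact h01
        · exact h1q }
  exact Order.LTSeries.length_le_krullDim c

lemma le_of_specSurj_kPlus (S : Subalgebra k K) [UniqueFactorizationMonoid S] (P : Ideal S)
    (hP : ∀ π : S, Irreducible π → ¬ P ≤ Ideal.span {π})
    [hfrac : IsFractionRing (kPlus S P) K] (S' : Subalgebra k K) (hle : kPlus S P ≤ S')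
    (hsurj : ∀ p : Ideal (kPlus S P), p.IsPrime →
      ∃ q : Ideal S', q.IsPrime ∧ q.comap (Subalgebra.inclusion hle) = p) :
    S' ≤ S := by
  intro g hg
  obtain ⟨r, s, hs, hrs⟩ := IsFractionRing.div_surjective (A := kPlus S P) g
  let ι := Subalgebra.inclusion (kPlus_le S P)
  have hs0 : (s : K) ≠ 0 := by
    simpa using nonZeroDivisors.ne_zero hs
  have hιs0 : ι s ≠ 0 := fun h => hs0 (congrArg (Subtype.val : S → K) h)
  obtain ⟨b, a, c, hrel, hb, ha⟩ :=
    UniqueFactorizationMonoid.exists_reduced_factors (ι s) hιs0 (ι r)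
  have hc0 : (c : K) ≠ 0 := by
    rintro h
    apply hιs0
    rw [← hb, show c = 0 from Subtype.ext h, zero_mul]
  have hgb : g * b = a := by
    have hr' : (c : K) * a = r := congrArg (Subtype.val : S → K) ha
    have hs' : (c : K) * b = s := congrArg (Subtype.val : S → K) hb
    have hgs : g * s = r := by
      rw [← hrs]
      exact div_mul_cancel₀ _ hs0
    apply mul_left_cancel₀ hc0
    rw [hr', ← hgs, ← hs']
    ring
  by_cases hbu : IsUnit b
  · obtain ⟨d, hd⟩ := hbu.exists_right_inv
    have hd' : (b : K) * d = 1 := congrArg (Subtype.val : S → K) hd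
    have : g = (a * d : S) := by
      push_cast
      rw [← hgb, mul_assoc, hd', mul_one]
    rw [this]
    exact (a * d).2
  exfalso
  have hb0 : b ≠ 0 := by
    rintro rfl
    exact hιs0 (by rw [← hb, mul_zero])
  obtain ⟨π, hπ, hπb⟩ := WfDvdMonoid.exists_irreducible_factor hbu hb0
  have hπa : ¬ π ∣ a := fun h => hπ.not_isUnit (hrel hπb h)
  have hπp : (Ideal.span {π}).IsPrime :=
    (Ideal.span_singleton_prime hπ.ne_zero).mpr
      (UniqueFactorizationMonoid.irreducible_iff_prime.mp hπ)
  obtain ⟨f, hfP, hfπ⟩ := SetLike.not_le_iff_exists.mp (hP π hπ)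
  obtain ⟨q, hq, hqp⟩ := hsurj ((Ideal.span {π}).comap ι) (hπp.comap _)
  let bf : kPlus S P := ⟨_, coe_mem_kPlus (P.mul_mem_left b hfP)⟩
  let af : kPlus S P := ⟨_, coe_mem_kPlus (P.mul_mem_left a hfP)⟩
  have hbf : bf ∈ q.comap (Subalgebra.inclusion hle) := by
    rw [hqp]
    exact Ideal.mul_mem_right f _ (Ideal.mem_span_singleton.mpr hπb)
  have haf : af ∈ q.comap (Subalgebra.inclusion hle) := by
    have : Subalgebra.inclusion hle af = ⟨g, hg⟩ * Subalgebra.inclusion hle bf := by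
      apply Subtype.ext
      change ((a * f : S) : K) = g * ((b * f : S) : K)
      push_cast
      rw [← mul_assoc, hgb]
    rw [Ideal.mem_comap, this]
    exact q.mul_mem_left _ hbf
  rw [hqp] at haf
  have haf' : a * f ∈ Ideal.span {π} := haf
  exact (hπp.mem_or_mem haf').elim (fun h => hπa (Ideal.mem_span_singleton.mp h)) hfπ

end


/-- With `S₁ = k[x,y,z]` and `R = k + (x,y)S₁`: `R` is noetherian in codimension 1 and `S₁`
is the unique maximal depiction of `R`. -/
theorem polynomial_ring_unique_maximal_depiction
    (k K : Type*) [Field k] [IsAlgClosed k] [Field K] [Algebra k K]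
    (x y z : K) (hxyz : AlgebraicIndependent k ![x, y, z])
    (S₁ : Subalgebra k K) (hSdef : S₁ = Algebra.adjoin k {x, y, z})
    (hxS : x ∈ S₁) (hyS : y ∈ S₁)
    (R : Subalgebra k K) (hRdef : R = kPlus S₁ (Ideal.span {⟨x, hxS⟩, ⟨y, hyS⟩}))
    (hfrac : IsFractionRing ↥R K) :
    NoethCodimOne R ∧
      IsDepiction R S₁ ∧
      ∀ S' : Subalgebra k K, IsDepiction R S' → S' ≤ S₁ := by
  have hrange : Set.range ![x, y, z] = {x, y, z} := by
    simp only [Matrix.range_cons, Matrix.range_empty, Set.union_empty, Set.singleton_union]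
  rw [← hrange] at hSdef
  subst hSdef hRdef
  set S := Algebra.adjoin k (Set.range ![x, y, z])
  let e : MvPolynomial (Fin 3) k ≃ₐ[k] S := hxyz.aevalEquiv
  have he : ∀ i, ((e (MvPolynomial.X i) : S) : K) = ![x, y, z] i := fun i =>
    (hxyz.algebraMap_aevalEquiv _).trans (MvPolynomial.aeval_X _ i)
  have hFG : S.FG := Subalgebra.fg_def.mpr ⟨_, Set.finite_range _, rfl⟩
  have hUFM : UniqueFactorizationMonoid S := e.toMulEquiv.uniqueFactorizationMonoid inferInstance
  have hJac : IsJacobsonRing S := (isJacobsonRing_iso e.toRingEquiv).mp inferInstance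
  have hprime : ∀ i, Prime (e (MvPolynomial.X i)) := fun i =>
    (MulEquiv.prime_iff e.toMulEquiv).mpr MvPolynomial.X_prime
  have hdvd : ¬ e (MvPolynomial.X 0) ∣ e (MvPolynomial.X 1) := by
    rw [map_dvd_iff e, MvPolynomial.X_dvd_X]
    decide
  let φ : S →ₐ[k] Polynomial k :=
    (MvPolynomial.aeval ![0, 0, Polynomial.X]).comp e.symm.toAlgHom
  have hφ : ∀ i, φ (e (MvPolynomial.X i)) = ![0, 0, Polynomial.X] i := fun i => by simp [φ]
  have hx : (⟨x, hxS⟩ : S) = e (MvPolynomial.X 0) := Subtype.ext (he 0).symm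
  have hy : (⟨y, hyS⟩ : S) = e (MvPolynomial.X 1) := Subtype.ext (he 1).symm
  rw [hx, hy] at hfrac ⊢
  set X := e (MvPolynomial.X 0)
  set Y := e (MvPolynomial.X 1)
  set P : Ideal S := Ideal.span {X, Y}
  have hXP : X ∈ P := Ideal.subset_span (by simp)
  have hYP : Y ∈ P := Ideal.subset_span (by simp)
  have hφP : ∀ f ∈ P, φ f = 0 := by
    have : P ≤ RingHom.ker φ := by
      rw [Ideal.span_le]
      rintro _ (rfl | rfl)
      · exact hφ 0
      · exact hφ 1
    exact this
  have hP : P ≠ ⊤ := fun h => by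
    simpa using hφP 1 (h ▸ Submodule.mem_top)
  have hX1 : Ideal.span {X - 1} ≠ (⊤ : Ideal S) := by
    rw [Ne, Ideal.span_singleton_eq_top]
    intro hu
    have := hu.map (MvPolynomial.aeval (R := k) ![(1 : k), 0, 0]|>.comp e.symm.toAlgHom)
    simp [X] at this
  obtain ⟨n₀, hn₀, hle⟩ := Ideal.exists_le_maximal _ hX1
  have hPn₀ : ¬ P ≤ n₀ := fun h => hn₀.ne_top <| by
    rw [Ideal.eq_top_iff_one]
    simpa using n₀.sub_mem (h hXP) (hle (Ideal.mem_span_singleton_self _))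
  have hdep : IsDepiction (kPlus S P) S :=
    isDepiction_kPlus_s19 S hFG P hP φ hφP (hφ 2) hXP (hprime 0).ne_zero hn₀ hPn₀
  refine ⟨⟨S, hdep, fun q hq hht => memZ_kPlus S P q hq fun hPq => ?_⟩, hdep, fun S' hS' => ?_⟩
  · have hXprime : (Ideal.span {X}).IsPrime :=
      (Ideal.span_singleton_prime (hprime 0).ne_zero).mpr (hprime 0)
    have h2 : 2 ≤ htOf q := by
      refine two_le_htOf Ideal.isPrime_bot hXprime hq ?_ ?_
      · rw [bot_lt_iff_ne_bot, Ne, Ideal.span_singleton_eq_bot]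
        exact (hprime 0).ne_zero
      · refine lt_of_le_of_ne ((Ideal.span_singleton_le_iff_mem _).mpr (hPq hXP)) ?_
        intro h
        exact hdvd (Ideal.mem_span_singleton.mp (h ▸ hPq hYP))
    rw [hht] at h2
    exact absurd h2 (by decide)
  · refine le_of_specSurj_kPlus S P (fun π hπ hle => hdvd ?_) S' hS'.le hS'.specSurj
    have hπX : π ∣ X := Ideal.mem_span_singleton.mp (hle hXP)
    have hπY : π ∣ Y := Ideal.mem_span_singleton.mp (hle hYP)
    exact ((hπ.dvd_symm (hprime 0).irreducible hπX).trans hπY)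
end
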